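/- Let 0 ≤ μ < 1 and λ > 0, and A(t) = exp(∫₀ᵗ λ/(2(1+τ)^μ) dτ). Then there exist constants C₁, C₂ > 0 such that for all t ≥ 0, A(t)^{−1} ∫₀ᵗ A(s)(1+s)^{−(μ+1)} ds ≤ C₁ ( exp(−C₂ (1+t)^{1−μ}) + (1+t)^{−μ} ). -/

import Mathlib

noncomputable section
open Real Set

/-- Partial derivative with respect to time of a function of `(t, x)`. -/
def pdt (f : ℝ → ℝ → ℝ) (t x : ℝ) : ℝ := deriv (fun τ => f τ x) t

/-- Partial derivative with respect to space of a function of `(t, x)`. -/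
def pdx (f : ℝ → ℝ → ℝ) (t x : ℝ) : ℝ := deriv (fun ξ => f t ξ) x

/-- The strip `[0,T] × ℝ`. -/
def strip (T : ℝ) : Set (ℝ × ℝ) := Set.Icc 0 T ×ˢ (Set.univ : Set ℝ)

/-- The half-space `[0,∞) × ℝ`. -/
def stripInf : Set (ℝ × ℝ) := Set.Ici (0 : ℝ) ×ˢ (Set.univ : Set ℝ)

/-- The pressure `p(u) = u^(-γ)/γ`. -/
def pres (γ u : ℝ) : ℝ := u ^ (-γ) / γ

/-- The sound speed `c(u) = u^(-(γ+1)/2)`. -/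
def cspeed (γ u : ℝ) : ℝ := u ^ (-(γ + 1) / 2)

/-- The first Riemann invariant `r = v - (2/(γ-1)) u^(-(γ-1)/2) + 2/(γ-1)`. -/
def rInv (γ u v : ℝ) : ℝ := v - (2 / (γ - 1)) * u ^ (-(γ - 1) / 2) + 2 / (γ - 1)

/-- The second Riemann invariant `s = v + (2/(γ-1)) u^(-(γ-1)/2) - 2/(γ-1)`. -/
def sInv (γ u v : ℝ) : ℝ := v + (2 / (γ - 1)) * u ^ (-(γ - 1) / 2) - 2 / (γ - 1)

/-- `(u,v)` solves the damped compressible Euler system on the set `S`. -/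
def IsEulerOn (γ lam μ : ℝ) (u v : ℝ → ℝ → ℝ) (S : Set (ℝ × ℝ)) : Prop :=
  ∀ p ∈ S, pdt u p.1 p.2 - pdx v p.1 p.2 = 0 ∧
    pdt v p.1 p.2 + pdx (fun t x => pres γ (u t x)) p.1 p.2
      = -(lam / (1 + p.1) ^ μ) * v p.1 p.2

/-- `f` is `C¹` on `S ⊆ ℝ × ℝ`. -/
def IsC1On (f : ℝ → ℝ → ℝ) (S : Set (ℝ × ℝ)) : Prop :=
  ContDiffOn ℝ 1 (fun p : ℝ × ℝ => f p.1 p.2) S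

/-- `f` is `C²` on `S ⊆ ℝ × ℝ`. -/
def IsC2On (f : ℝ → ℝ → ℝ) (S : Set (ℝ × ℝ)) : Prop :=
  ContDiffOn ℝ 2 (fun p : ℝ × ℝ => f p.1 p.2) S

/-- `f` is `C¹_b` on `S ⊆ ℝ × ℝ`: `C¹` with `f` and its first partials bounded. -/
def IsC1bOn (f : ℝ → ℝ → ℝ) (S : Set (ℝ × ℝ)) : Prop :=
  IsC1On f S ∧ ∃ M : ℝ, ∀ p ∈ S, |f p.1 p.2| + |pdt f p.1 p.2| + |pdx f p.1 p.2| ≤ M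

/-- `f : ℝ → ℝ` is `C¹_b`. -/
def IsC1b (f : ℝ → ℝ) : Prop :=
  ContDiff ℝ 1 f ∧ ∃ M : ℝ, ∀ x, |f x| + |deriv f x| ≤ M

/-- The damping coefficient `λ/(2(1+t)^μ)`. -/
def damp (lam μ t : ℝ) : ℝ := lam / (2 * (1 + t) ^ μ)

/-- `A(t) = exp(∫₀ᵗ λ/(2(1+τ)^μ) dτ)`. -/
def Afun (lam μ t : ℝ) : ℝ := Real.exp (∫ τ in (0 : ℝ)..t, damp lam μ τ)

/-- `θ_γ(u)`. -/
def theta (γ u : ℝ) : ℝ :=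
  if γ = 3 then Real.log u else (4 / (3 - γ)) * (u ^ ((3 - γ) / 4) - 1)

theorem continuousAt_damp (lam μ : ℝ) {t : ℝ} (ht : 0 ≤ t) : ContinuousAt (damp lam μ) t := by
  have h1 : 0 < 1 + t := by linarith
  unfold damp
  refine ContinuousAt.div continuousAt_const (continuousAt_const.mul ?_) ?_
  · exact ContinuousAt.rpow_const (by fun_prop) (Or.inl h1.ne')
  · positivity

theorem measurable_damp (lam μ : ℝ) : Measurable (damp lam μ) := by
  unfold damp
  fun_prop

theorem Afun_pos (lam μ t : ℝ) : 0 < Afun lam μ t := Real.exp_pos _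

theorem hasDerivAt_Afun (lam μ : ℝ) {t : ℝ} (ht : 0 ≤ t) :
    HasDerivAt (Afun lam μ) (Afun lam μ t * damp lam μ t) t := by
  have hint : IntervalIntegrable (damp lam μ) MeasureTheory.volume 0 t := by
    refine ContinuousOn.intervalIntegrable fun x hx => ?_
    rw [uIcc_of_le ht] at hx
    exact (continuousAt_damp lam μ hx.1).continuousWithinAt
  exact (intervalIntegral.integral_hasDerivAt_right hint
    (measurable_damp lam μ).stronglyMeasurable.stronglyMeasurableAtFilter
    (continuousAt_damp lam μ ht)).exp

theorem monotoneOn_Afun {lam : ℝ} (hlam : 0 ≤ lam) (μ : ℝ) : MonotoneOn (Afun lam μ) (Ici 0) := by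
  refine monotoneOn_of_hasDerivWithinAt_nonneg (f' := fun t => Afun lam μ t * damp lam μ t)
    (convex_Ici 0)
    (fun t ht => (hasDerivAt_Afun lam μ ht).continuousAt.continuousWithinAt) ?_ ?_
  · intro t ht
    rw [interior_Ici] at ht
    exact (hasDerivAt_Afun lam μ (le_of_lt ht)).hasDerivWithinAt
  · intro t ht
    rw [interior_Ici] at ht
    have h1 : 0 < 1 + t := by linarith [mem_Ioi.mp ht]
    have := Afun_pos lam μ t
    unfold damp
    positivity

theorem continuousOn_Afun_mul_rpow (lam μ a : ℝ) :
    ContinuousOn (fun s => Afun lam μ s * (1 + s) ^ a) (Ici 0) := by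
  intro s hs
  have h1 : 0 < 1 + s := by linarith [mem_Ici.mp hs]
  exact ((hasDerivAt_Afun lam μ hs).continuousAt.mul
    (ContinuousAt.rpow_const (by fun_prop) (Or.inl h1.ne'))).continuousWithinAt

theorem intervalIntegrable_Afun_mul_rpow (lam μ a : ℝ) {x y : ℝ} (hx : 0 ≤ x) (hy : 0 ≤ y) :
    IntervalIntegrable (fun s => Afun lam μ s * (1 + s) ^ a) MeasureTheory.volume x y :=
  ((continuousOn_Afun_mul_rpow lam μ a).mono
    fun _ hs => le_trans (le_min hx hy) hs.1).intervalIntegrable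

theorem hasDerivAt_Afun_mul_rpow (lam μ : ℝ) {t : ℝ} (ht : 0 ≤ t) :
    HasDerivAt (fun s => Afun lam μ s * (1 + s) ^ (-μ))
      (Afun lam μ t * (1 + t) ^ (-(μ + 1)) * (lam / 2 * (1 + t) ^ (1 - μ) - μ)) t := by
  have h1 : 0 < 1 + t := by linarith
  have h := (hasDerivAt_Afun lam μ ht).mul
    (((hasDerivAt_id t).const_add 1).rpow_const (p := -μ) (Or.inl h1.ne'))
  refine h.congr_deriv ?_
  have e1 : (1 + t) ^ (-(μ + 1)) * (1 + t) ^ (1 - μ) = (1 + t) ^ (-μ) * (1 + t) ^ (-μ) := by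
    rw [← rpow_add h1, ← rpow_add h1]
    ring_nf
  have e2 : damp lam μ t = lam / 2 * (1 + t) ^ (-μ) := by
    rw [damp, rpow_neg h1.le]
    ring
  have e3 : (1 + t) ^ (-μ - 1) = (1 + t) ^ (-(μ + 1)) := by ring_nf
  simp only [id, e2, e3]
  linear_combination -(Afun lam μ t * lam / 2) * e1

theorem integral_Afun_mul_rpow_le_mul {lam μ t : ℝ} (hlam : 0 ≤ lam) (hμ : 0 ≤ μ) (ht : 0 ≤ t) :
    ∫ s in (0:ℝ)..t, Afun lam μ s * (1 + s) ^ (-(μ + 1)) ≤ t * Afun lam μ t := by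
  have h : ∫ s in (0:ℝ)..t, Afun lam μ s * (1 + s) ^ (-(μ + 1)) ≤ ∫ _ in (0:ℝ)..t, Afun lam μ t := by
    refine intervalIntegral.integral_mono_on ht
      (intervalIntegrable_Afun_mul_rpow lam μ _ le_rfl ht) intervalIntegrable_const fun s hs => ?_
    calc Afun lam μ s * (1 + s) ^ (-(μ + 1)) ≤ Afun lam μ s * 1 := by
          gcongr
          · exact (Afun_pos lam μ s).le
          · exact rpow_le_one_of_one_le_of_nonpos (by linarith [hs.1]) (by linarith)
      _ ≤ Afun lam μ t := by
          rw [mul_one]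
          exact monotoneOn_Afun hlam μ hs.1 ht hs.2
  simpa using h

theorem integral_Afun_mul_rpow_le_sub {lam μ T t : ℝ} (hlam : 0 ≤ lam) (hμ : μ ≤ 1) (hT : 0 ≤ T)
    (hTt : T ≤ t) (hlarge : μ + 1 ≤ lam / 2 * (1 + T) ^ (1 - μ)) :
    ∫ s in T..t, Afun lam μ s * (1 + s) ^ (-(μ + 1))
      ≤ Afun lam μ t * (1 + t) ^ (-μ) - Afun lam μ T * (1 + T) ^ (-μ) := by
  refine intervalIntegral.integral_le_sub_of_hasDeriv_right_of_le hTt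
    ((continuousOn_Afun_mul_rpow lam μ (-μ)).mono fun s hs => hT.trans hs.1)
    (fun s hs => (hasDerivAt_Afun_mul_rpow lam μ (hT.trans hs.1.le)).hasDerivWithinAt)
    (((continuousOn_Afun_mul_rpow lam μ _).mono fun s hs => hT.trans hs.1).integrableOn_Icc)
    fun s hs => ?_
  have h1 : 0 < 1 + s := by linarith [hs.1]
  have hA := Afun_pos lam μ s
  refine le_mul_of_one_le_right (by positivity) ?_
  have : lam / 2 * (1 + T) ^ (1 - μ) ≤ lam / 2 * (1 + s) ^ (1 - μ) := by
    have := rpow_le_rpow (by linarith : 0 ≤ 1 + T) (by linarith [hs.1] : 1 + T ≤ 1 + s)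
      (by linarith : 0 ≤ 1 - μ)
    gcongr
  linarith

theorem exists_nonneg_le_mul_rpow {lam a : ℝ} (hlam : 0 < lam) (ha : 0 < a) (b : ℝ) :
    ∃ T ≥ (0:ℝ), b ≤ lam * (1 + T) ^ a := by
  have h := ((tendsto_rpow_atTop ha).comp
    (Filter.tendsto_atTop_add_const_left Filter.atTop (1:ℝ) Filter.tendsto_id)).const_mul_atTop hlam
  obtain ⟨T, hT, hT0⟩ :=
    ((h.eventually_ge_atTop b).and (Filter.eventually_ge_atTop (0:ℝ))).exists
  exact ⟨T, hT0, hT⟩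

theorem exists_integral_Afun_mul_rpow_le {lam μ : ℝ} (hμ0 : 0 ≤ μ) (hμ1 : μ < 1) (hlam : 0 < lam) :
    ∃ C > 0, ∀ t ≥ (0:ℝ), ∫ s in (0:ℝ)..t, Afun lam μ s * (1 + s) ^ (-(μ + 1))
      ≤ C * (Afun lam μ t * (1 + t) ^ (-μ)) := by
  obtain ⟨T, hT, hlarge⟩ :=
    exists_nonneg_le_mul_rpow (half_pos hlam) (sub_pos.mpr hμ1) (μ + 1)
  have hT1 : 0 < 1 + T := by linarith
  set C := 1 + T * (1 + T) ^ μ with hC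
  have hC1 : 1 ≤ C := by
    have : 0 ≤ T * (1 + T) ^ μ := by positivity
    linarith
  have hsmall : ∀ t, 0 ≤ t → t ≤ T → ∫ s in (0:ℝ)..t, Afun lam μ s * (1 + s) ^ (-(μ + 1))
      ≤ C * (Afun lam μ t * (1 + t) ^ (-μ)) := by
    intro t ht htT
    have ht1 : 0 < 1 + t := by linarith
    have hbound : t ≤ C * (1 + t) ^ (-μ) := by
      rw [rpow_neg ht1.le, ← div_eq_mul_inv, le_div_iff₀ (by positivity)]
      have : t * (1 + t) ^ μ ≤ T * (1 + T) ^ μ := by gcongr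
      linarith
    calc _ ≤ t * Afun lam μ t := integral_Afun_mul_rpow_le_mul hlam.le hμ0 ht
      _ ≤ C * (1 + t) ^ (-μ) * Afun lam μ t :=
          mul_le_mul_of_nonneg_right hbound (Afun_pos lam μ t).le
      _ = _ := by ring
  refine ⟨C, by linarith, fun t ht => ?_⟩
  rcases le_total t T with htT | hTt
  · exact hsmall t ht htT
  · rw [← intervalIntegral.integral_add_adjacent_intervals
      (intervalIntegrable_Afun_mul_rpow lam μ _ le_rfl hT)
      (intervalIntegrable_Afun_mul_rpow lam μ _ hT ht)]
    have hI := integral_Afun_mul_rpow_le_sub hlam.le hμ1.le hT hTt hlarge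
    have hmono : 0 ≤ Afun lam μ t * (1 + t) ^ (-μ) - Afun lam μ T * (1 + T) ^ (-μ) := by
      refine le_trans (intervalIntegral.integral_nonneg hTt fun s hs => ?_) hI
      have h1 : 0 < 1 + s := by linarith [hs.1]
      have := Afun_pos lam μ s
      positivity
    linarith [hsmall T hT le_rfl, le_mul_of_one_le_left hmono hC1]

/-- For `0 ≤ μ < 1` and `λ > 0`,
`A(t)⁻¹ ∫₀ᵗ A(s)(1+s)^(-(μ+1)) ds ≤ C₁ (exp(-C₂(1+t)^(1-μ)) + (1+t)^(-μ))`. -/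
theorem Afun_tail_estimate
    (lam μ : ℝ) (hμ0 : 0 ≤ μ) (hμ1 : μ < 1) (hlam : 0 < lam) :
    ∃ C₁ > 0, ∃ C₂ > 0, ∀ t ≥ (0:ℝ),
      (Afun lam μ t)⁻¹ * (∫ s in (0:ℝ)..t, Afun lam μ s * (1 + s) ^ (-(μ + 1)))
        ≤ C₁ * (Real.exp (-C₂ * (1 + t) ^ (1 - μ)) + (1 + t) ^ (-μ)) := by
  obtain ⟨C, hC, h⟩ := exists_integral_Afun_mul_rpow_le hμ0 hμ1 hlam
  refine ⟨C, hC, 1, one_pos, fun t ht => ?_⟩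
  rw [inv_mul_le_iff₀ (Afun_pos lam μ t)]
  have hA := Afun_pos lam μ t
  calc _ ≤ C * (Afun lam μ t * (1 + t) ^ (-μ)) := h t ht
    _ = Afun lam μ t * (C * (1 + t) ^ (-μ)) := by ring
    _ ≤ _ := by
      gcongr
      exact le_add_of_nonneg_left (Real.exp_pos _).le
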